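/- For every n ≥ 1, the symmetric coinvariant algebra R_n = B_n/J_n is finite dimensional over ℂ with dim_ℂ R_n = n! + (n−1)·n!/2 = (n+1)!/2. -/

import Mathlib

open MvPolynomial

set_option maxHeartbeats 1000000
set_option synthInstance.maxHeartbeats 400000

noncomputable section

/-- the ideal `(x₁y₁, …, xₙyₙ)`. -/
abbrev Bideal (n : ℕ) : Ideal (MvPolynomial (Fin n ⊕ Fin n) ℂ) :=
  Ideal.span (Set.range fun i : Fin n => X (Sum.inl i) * X (Sum.inr i))

/-- `B n = ℂ[x₁,…,xₙ,y₁,…,yₙ]/(x₁y₁,…,xₙyₙ)`, the `n`-th tensor power of `ℂ[x,y]/(xy)`.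
The variable `x_i` is `X (Sum.inl i)` and `y_i` is `X (Sum.inr i)`. -/
abbrev B (n : ℕ) : Type := MvPolynomial (Fin n ⊕ Fin n) ℂ ⧸ Bideal n

abbrev mkB (n : ℕ) : MvPolynomial (Fin n ⊕ Fin n) ℂ →ₐ[ℂ] B n :=
  Ideal.Quotient.mkₐ ℂ (Bideal n)

def xv (n : ℕ) (i : Fin n) : B n := mkB n (X (Sum.inl i))
def yv (n : ℕ) (i : Fin n) : B n := mkB n (X (Sum.inr i))

/-- the action of a permutation `σ ∈ Sₙ` on `B n`: `σ·xᵢ = x_{σ i}`, `σ·yᵢ = y_{σ i}`. -/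
def permB (n : ℕ) (σ : Equiv.Perm (Fin n)) : B n →ₐ[ℂ] B n :=
  Ideal.Quotient.liftₐ (Bideal n)
    ((mkB n).comp (MvPolynomial.rename (Sum.map ⇑σ ⇑σ)))
    (by
      intro a ha
      have h : Bideal n ≤ RingHom.ker ((mkB n).comp (MvPolynomial.rename (Sum.map ⇑σ ⇑σ))).toRingHom := by
        rw [Ideal.span_le]
        rintro _ ⟨i, rfl⟩
        simp only [SetLike.mem_coe, RingHom.mem_ker, AlgHom.toRingHom_eq_coe, RingHom.coe_coe,
          AlgHom.comp_apply, map_mul, rename_X, Sum.map_inl, Sum.map_inr]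
        rw [← map_mul, Ideal.Quotient.mkₐ_eq_mk, Ideal.Quotient.eq_zero_iff_mem]
        exact Ideal.subset_span ⟨σ i, rfl⟩
      exact h ha)

/-- evaluation at the origin. -/
def ev0 (n : ℕ) : B n →ₐ[ℂ] ℂ :=
  Ideal.Quotient.liftₐ (Bideal n) (aeval fun _ => (0 : ℂ))
    (by
      intro a ha
      have h : Bideal n ≤ RingHom.ker (aeval (R := ℂ) fun _ : Fin n ⊕ Fin n => (0 : ℂ)).toRingHom := by
        rw [Ideal.span_le]
        rintro _ ⟨i, rfl⟩
        simp [RingHom.mem_ker]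
      exact h ha)

/-- `Jₙ`, the ideal of `B n` generated by the `Sₙ`-invariant elements vanishing at the origin. -/
def Jn (n : ℕ) : Ideal (B n) :=
  Ideal.span {p : B n | (∀ σ : Equiv.Perm (Fin n), permB n σ p = p) ∧ ev0 n p = 0}

/-- the symmetric coinvariant algebra `Rₙ = Bₙ/Jₙ`. -/
abbrev Rn (n : ℕ) : Type := B n ⧸ Jn n

/-- The exponent of the monomial `∏_{a i > 0} x_i ^ (a i) * ∏_{a i < 0} y_i ^ (-a i)`. -/
def signedExp {n : ℕ} (a : Fin n → ℤ) : Fin n ⊕ Fin n →₀ ℕ :=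
  Finsupp.equivFunOnFinite.symm (Sum.elim (fun i => (a i).toNat) fun i => (-a i).toNat)

@[simp] lemma signedExp_inl {n : ℕ} (a : Fin n → ℤ) (i : Fin n) :
    signedExp a (Sum.inl i) = (a i).toNat := rfl

@[simp] lemma signedExp_inr {n : ℕ} (a : Fin n → ℤ) (i : Fin n) :
    signedExp a (Sum.inr i) = (-a i).toNat := rfl

/-- The quotient map from the polynomial ring to the coinvariant algebra. -/
def toRn (n : ℕ) : MvPolynomial (Fin n ⊕ Fin n) ℂ →ₐ[ℂ] Rn n :=
  (Ideal.Quotient.mkₐ ℂ (Jn n)).comp (mkB n)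

lemma toRn_surjective (n : ℕ) : Function.Surjective (toRn n) :=
  (Ideal.Quotient.mkₐ_surjective ℂ (Jn n)).comp (Ideal.Quotient.mkₐ_surjective ℂ (Bideal n))

lemma mkB_eq_zero_iff {n : ℕ} (p : MvPolynomial (Fin n ⊕ Fin n) ℂ) :
    mkB n p = 0 ↔ p ∈ Bideal n := by
  rw [Ideal.Quotient.mkₐ_eq_mk, Ideal.Quotient.eq_zero_iff_mem]

lemma toRn_eq_zero_iff {n : ℕ} (p : MvPolynomial (Fin n ⊕ Fin n) ℂ) :
    toRn n p = 0 ↔ mkB n p ∈ Jn n := by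
  rw [toRn, AlgHom.comp_apply, Ideal.Quotient.mkₐ_eq_mk, Ideal.Quotient.eq_zero_iff_mem]

lemma monomial_mem_Bideal {n : ℕ} {d : Fin n ⊕ Fin n →₀ ℕ} {i : Fin n}
    (h₁ : d (Sum.inl i) ≠ 0) (h₂ : d (Sum.inr i) ≠ 0) (c : ℂ) :
    monomial d c ∈ Bideal n := by
  have hle : Finsupp.single (Sum.inl i) 1 + Finsupp.single (Sum.inr i) 1 ≤ d := by
    intro s
    rcases s with j | j <;> by_cases h : i = j <;> simp [h]
    · subst h; omega
    · subst h; omega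
  have : monomial d c = monomial (d - (Finsupp.single (Sum.inl i) 1 + Finsupp.single (Sum.inr i) 1)) c
      * (X (Sum.inl i) * X (Sum.inr i)) := by
    rw [X, X, monomial_mul, monomial_mul, tsub_add_cancel_of_le hle]
    simp
  rw [this]
  exact Ideal.mul_mem_left _ _ (Ideal.subset_span ⟨i, rfl⟩)

lemma toRn_monomial_eq_zero {n : ℕ} {d : Fin n ⊕ Fin n →₀ ℕ} {i : Fin n}
    (h₁ : d (Sum.inl i) ≠ 0) (h₂ : d (Sum.inr i) ≠ 0) (c : ℂ) :
    toRn n (monomial d c) = 0 := by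
  rw [toRn, AlgHom.comp_apply, (mkB_eq_zero_iff _).2 (monomial_mem_Bideal h₁ h₂ c), map_zero]

lemma permB_mkB {n : ℕ} (σ : Equiv.Perm (Fin n)) (p : MvPolynomial (Fin n ⊕ Fin n) ℂ) :
    permB n σ (mkB n p) = mkB n (rename (Sum.map σ σ) p) := rfl

lemma ev0_mkB {n : ℕ} (p : MvPolynomial (Fin n ⊕ Fin n) ℂ) :
    ev0 n (mkB n p) = constantCoeff p := by
  have : ev0 n (mkB n p) = aeval (fun _ => (0 : ℂ)) p := rfl
  rw [this, aeval_zero']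
  simp

/-- Elementary symmetric polynomials of positive degree in the variables of either kind vanish. -/
lemma toRn_rename_esymm {n k : ℕ} (hk : k ≠ 0) (f : Fin n → Fin n ⊕ Fin n)
    (hf : ∀ σ : Equiv.Perm (Fin n), Sum.map σ σ ∘ f = f ∘ σ) :
    toRn n (rename f (esymm (Fin n) ℂ k)) = 0 := by
  rw [toRn_eq_zero_iff]
  refine Ideal.subset_span ⟨fun σ => ?_, ?_⟩
  · rw [permB_mkB, rename_rename, hf, ← rename_rename, rename_esymm]
  · rw [ev0_mkB, constantCoeff_rename, esymm, map_sum]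
    refine Finset.sum_eq_zero fun T hT => ?_
    rw [map_prod]
    obtain ⟨i, hi⟩ : T.Nonempty := by
      rw [← Finset.card_pos, (Finset.mem_powersetCard.1 hT).2]; omega
    exact Finset.prod_eq_zero hi (by simp)

/-- The statistic on signed exponents with respect to which straightening is triangular. -/
def weight {n : ℕ} (a : Fin n → ℤ) : ℤ := ∑ i, ((n : ℤ) * a i ^ 2 - 2 * (i : ℤ) * a i)

lemma weight_bound {n : ℕ} (a : Fin n → ℤ) : -((n : ℤ) * n) ≤ weight a := by
  have : ∀ i ∈ (Finset.univ : Finset (Fin n)),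
      -(n : ℤ) ≤ (n : ℤ) * a i ^ 2 - 2 * (i : ℤ) * a i := by
    intro i _
    have hi : (i : ℤ) < n := by exact_mod_cast i.2
    have hi0 : (0 : ℤ) ≤ i := by positivity
    rcases le_or_gt (a i) 0 with h | h
    · nlinarith [sq_nonneg (a i), mul_nonneg hi0 (neg_nonneg.2 h)]
    · have h1 : 1 ≤ a i := h
      nlinarith [mul_nonneg (sub_nonneg.2 hi.le) h.le, mul_nonneg (by linarith : (0:ℤ) ≤ n)
        (sq_nonneg (a i - 1))]
  have h2 := Finset.sum_le_sum this
  simp only [Finset.sum_const, Finset.card_univ, Fintype.card_fin, nsmul_eq_mul] at h2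
  rw [weight]; linarith

/-- Among sets of a given size, an upper set for `f` is the only one of largest total value. -/
lemma Finset.sum_lt_sum_of_upper {ι : Type*} [DecidableEq ι] {S T : Finset ι} (f : ι → ℤ)
    (hcard : T.card = S.card) (hne : T ≠ S) (h : ∀ i ∈ S, ∀ j ∉ S, f j < f i) :
    ∑ i ∈ T, f i < ∑ i ∈ S, f i := by
  have hc : (T \ S).card = (S \ T).card := by
    have h1 := Finset.card_sdiff_add_card_inter T S
    have h2 := Finset.card_sdiff_add_card_inter S T
    rw [Finset.inter_comm] at h2
    omega
  have hne' : (S \ T).Nonempty := by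
    rw [Finset.nonempty_iff_ne_empty]
    intro h0
    exact hne (Finset.eq_of_subset_of_card_le (Finset.sdiff_eq_empty_iff_subset.1 h0) hcard.le).symm
  have hne2 : (T \ S).Nonempty := by rw [← Finset.card_pos, hc, Finset.card_pos]; exact hne'
  obtain ⟨m, hm, hmin⟩ := Finset.exists_min_image (S \ T) f hne'
  have h1 : ∑ i ∈ T \ S, f i < ∑ i ∈ T \ S, f m :=
    Finset.sum_lt_sum_of_nonempty hne2 fun i hi =>
      h m (Finset.mem_sdiff.1 hm).1 i (Finset.mem_sdiff.1 hi).2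
  have h2 : ∑ i ∈ S \ T, f m ≤ ∑ i ∈ S \ T, f i := Finset.sum_le_sum hmin
  simp only [Finset.sum_const, hc] at h1 h2
  have h3 := Finset.sum_sdiff (f := f) (Finset.inter_subset_left (s₁ := T) (s₂ := S))
  have h4 := Finset.sum_sdiff (f := f) (Finset.inter_subset_left (s₁ := S) (s₂ := T))
  rw [Finset.sdiff_inter_self_left] at h3 h4
  rw [Finset.inter_comm S T] at h4
  linarith

/-- A signed exponent is reduced if its values form an interval containing `0` and, for any two
consecutive values, some index carrying the larger exceeds some index carrying the smaller. -/
def IsReducedExp {n : ℕ} (a : Fin n → ℤ) : Prop :=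
  (∀ v : ℤ, 1 ≤ v → (∃ i, v ≤ a i) → ∃ i j, a i = v ∧ a j = v - 1 ∧ j < i) ∧
  (∀ v : ℤ, 1 ≤ v → (∃ i, a i ≤ -v) → ∃ i j, a i = -v ∧ a j = -v + 1 ∧ i < j)

lemma weight_add_indicator {n : ℕ} (b : Fin n → ℤ) (T : Finset (Fin n)) (ε : ℤ) (hε : ε ^ 2 = 1) :
    weight (fun i => b i + if i ∈ T then ε else 0) =
      weight b + n * T.card + 2 * ∑ i ∈ T, ε * ((n : ℤ) * b i - i) := by
  have h1 : ∑ i ∈ T, ε * ((n : ℤ) * b i - i) =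
      ∑ i, if i ∈ T then ε * ((n : ℤ) * b i - i) else 0 := by
    rw [Finset.sum_ite_mem, Finset.univ_inter]
  have h2 : (n : ℤ) * T.card = ∑ i, if i ∈ T then (n : ℤ) else 0 := by
    rw [Finset.sum_ite_mem, Finset.univ_inter, Finset.sum_const, nsmul_eq_mul, mul_comm]
  rw [weight, weight, h1, h2, Finset.mul_sum, ← Finset.sum_add_distrib, ← Finset.sum_add_distrib]
  refine Finset.sum_congr rfl fun i _ => ?_
  split_ifs
  · linear_combination (n : ℤ) * hε
  · ring

lemma monomial_mul_prod_X {n : ℕ} (b : Fin n → ℤ) (T : Finset (Fin n)) (f : Fin n → Fin n ⊕ Fin n) :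
    (monomial (signedExp b) (1 : ℂ)) * ∏ i ∈ T, X (f i) =
      monomial (signedExp b + ∑ i ∈ T, Finsupp.single (f i) 1) 1 := by
  simp only [X]
  rw [← monomial_sum_one, monomial_mul, one_mul]

lemma sum_single_apply_self {ι κ : Type*} {f : ι → κ} [DecidableEq ι] (hf : f.Injective)
    (T : Finset ι) (j : ι) :
    (∑ i ∈ T, Finsupp.single (f i) (1 : ℕ)) (f j) = if j ∈ T then 1 else 0 := by
  classical
  simp [Finsupp.finsetSum_apply, Finsupp.single_apply, hf.eq_iff]

lemma sum_single_apply_of_ne {ι κ : Type*} {f : ι → κ} (T : Finset ι) {s : κ} (h : ∀ i, f i ≠ s) :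
    (∑ i ∈ T, Finsupp.single (f i) (1 : ℕ)) s = 0 := by
  simp [Finsupp.finsetSum_apply, Finsupp.single_eq_of_ne' (h _)]

/-- The basic straightening relation. -/
lemma toRn_signedExp_mem {n : ℕ} (b : Fin n → ℤ) (S : Finset (Fin n)) (hS : S.Nonempty)
    (f : Fin n → Fin n ⊕ Fin n) (hf : ∀ σ : Equiv.Perm (Fin n), Sum.map σ σ ∘ f = f ∘ σ)
    (ε : ℤ) (hε : ε ^ 2 = 1)
    (hmul : ∀ T : Finset (Fin n),
      toRn n (monomial (signedExp b) 1 * ∏ i ∈ T, X (f i)) = 0 ∨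
      toRn n (monomial (signedExp b) 1 * ∏ i ∈ T, X (f i)) =
        toRn n (monomial (signedExp fun i => b i + if i ∈ T then ε else 0) 1))
    (hSb : toRn n (monomial (signedExp b) 1 * ∏ i ∈ S, X (f i)) =
        toRn n (monomial (signedExp fun i => b i + if i ∈ S then ε else 0) 1))
    (hup : ∀ i ∈ S, ∀ j ∉ S, ε * ((n : ℤ) * b j - j) < ε * ((n : ℤ) * b i - i))
    (W : Submodule ℂ (Rn n))
    (hW : ∀ a', weight a' < weight (fun i => b i + if i ∈ S then ε else 0) →
      toRn n (monomial (signedExp a') 1) ∈ W) :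
    toRn n (monomial (signedExp fun i => b i + if i ∈ S then ε else 0) 1) ∈ W := by
  have h0 := toRn_rename_esymm (n := n) (k := S.card) (Finset.card_pos.2 hS).ne' f hf
  have h1 : toRn n (monomial (signedExp b) 1 * rename f (esymm (Fin n) ℂ S.card)) = 0 := by
    rw [map_mul, h0]; exact mul_zero (M₀ := Rn n) _
  rw [esymm, map_sum, Finset.mul_sum, map_sum] at h1
  simp only [map_prod, rename_X] at h1
  rw [← Finset.add_sum_erase _ _ (Finset.mem_powersetCard.2 ⟨Finset.subset_univ S, rfl⟩)] at h1
  simp only [map_prod, map_mul] at h1 hSb hmul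
  rw [← hSb, eq_neg_of_add_eq_zero_left h1]
  refine W.neg_mem (W.sum_mem fun T hT => ?_)
  rw [Finset.mem_erase, Finset.mem_powersetCard] at hT
  obtain ⟨hTS, -, hcard⟩ := hT
  rcases hmul T with h | h
  · rw [h]; exact W.zero_mem
  · rw [h]
    refine hW _ ?_
    rw [weight_add_indicator _ _ _ hε, weight_add_indicator _ _ _ hε, hcard]
    have := Finset.sum_lt_sum_of_upper (fun i : Fin n => ε * ((n : ℤ) * b i - i)) hcard hTS hup
    linarith

lemma toRn_mem_of_not_isReduced {n : ℕ} (a : Fin n → ℤ) (ha : ¬ IsReducedExp a)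
    (W : Submodule ℂ (Rn n))
    (hW : ∀ a', weight a' < weight a → toRn n (monomial (signedExp a') 1) ∈ W) :
    toRn n (monomial (signedExp a) 1) ∈ W := by
  rw [IsReducedExp, not_and_or] at ha
  rcases ha with ha | ha <;> push Not at ha <;> obtain ⟨v, hv, ⟨i₀, hi₀⟩, hlt⟩ := ha
  · set S : Finset (Fin n) := Finset.univ.filter fun i => v ≤ a i with hS
    set b : Fin n → ℤ := fun i => a i - if i ∈ S then 1 else 0 with hb
    have hab : a = fun i => b i + if i ∈ S then 1 else 0 := by ext i; simp [hb]
    have key : ∀ T : Finset (Fin n), (∀ i ∈ T, 0 ≤ b i) →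
        monomial (signedExp b) (1 : ℂ) * ∏ i ∈ T, X (Sum.inl i) =
        monomial (signedExp fun i => b i + if i ∈ T then 1 else 0) 1 := by
      intro T hT
      rw [monomial_mul_prod_X]
      refine congrArg (fun d => monomial d (1 : ℂ)) (Finsupp.ext ?_)
      rintro (j | j) <;>
        simp only [Finsupp.add_apply, signedExp_inl, signedExp_inr,
          sum_single_apply_self Sum.inl_injective,
          sum_single_apply_of_ne (f := Sum.inl) T fun i => Sum.inl_ne_inr] <;>
        split_ifs with h <;> first | (have := hT j h; omega) | omega
    rw [hab] at hW ⊢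
    refine toRn_signedExp_mem b S ⟨i₀, by simpa [hS] using hi₀⟩ Sum.inl (fun σ => rfl) 1 (by norm_num)
      (fun T => ?_) ?_ ?_ W hW
    · by_cases hT : ∀ i ∈ T, 0 ≤ b i
      · exact Or.inr (by rw [key T hT])
      · push Not at hT
        obtain ⟨i, hi, hbi⟩ := hT
        left
        rw [monomial_mul_prod_X]
        refine toRn_monomial_eq_zero (i := i) ?_ ?_ _
        · simp [Finsupp.single_apply, hi]
        · simp; omega
    · rw [key S]
      intro i hi
      have : v ≤ a i := by simpa [hS] using hi
      simp only [hb, if_pos hi]; omega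
    · intro i hi j hj
      have h1 : v ≤ a i := by simpa [hS] using hi
      have h2 : a j < v := by simpa [hS] using hj
      have h3 := hlt i j
      have hin : (i : ℤ) < n := by exact_mod_cast i.2
      simp only [hb, if_pos hi, if_neg hj]
      by_cases h : a i = v ∧ a j = v - 1
      · have hij := h3 h.1 h.2
        have : i < j := lt_of_le_of_ne hij (by rintro rfl; omega)
        have : (i : ℤ) < j := by exact_mod_cast this
        rw [h.1, h.2]; linarith
      · have : a j + 1 ≤ a i - 1 := by omega
        nlinarith [Int.natCast_nonneg j.val]
  · set S : Finset (Fin n) := Finset.univ.filter fun i => a i ≤ -v with hS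
    set b : Fin n → ℤ := fun i => a i - if i ∈ S then -1 else 0 with hb
    have hab : a = fun i => b i + if i ∈ S then -1 else 0 := by ext i; simp [hb]
    have key : ∀ T : Finset (Fin n), (∀ i ∈ T, b i ≤ 0) →
        monomial (signedExp b) (1 : ℂ) * ∏ i ∈ T, X (Sum.inr i) =
        monomial (signedExp fun i => b i + if i ∈ T then -1 else 0) 1 := by
      intro T hT
      rw [monomial_mul_prod_X]
      refine congrArg (fun d => monomial d (1 : ℂ)) (Finsupp.ext ?_)
      rintro (j | j) <;>
        simp only [Finsupp.add_apply, signedExp_inl, signedExp_inr,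
          sum_single_apply_self Sum.inr_injective,
          sum_single_apply_of_ne (f := Sum.inr) T fun i => Sum.inr_ne_inl] <;>
        split_ifs with h <;> first | (have := hT j h; omega) | omega
    rw [hab] at hW ⊢
    refine toRn_signedExp_mem b S ⟨i₀, by simpa [hS] using hi₀⟩ Sum.inr (fun σ => rfl) (-1)
      (by norm_num) (fun T => ?_) ?_ ?_ W hW
    · by_cases hT : ∀ i ∈ T, b i ≤ 0
      · exact Or.inr (by rw [key T hT])
      · push Not at hT
        obtain ⟨i, hi, hbi⟩ := hT
        left
        rw [monomial_mul_prod_X]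
        refine toRn_monomial_eq_zero (i := i) ?_ ?_ _
        · simp; omega
        · simp [Finsupp.single_apply, hi]
    · rw [key S]
      intro i hi
      have : a i ≤ -v := by simpa [hS] using hi
      simp only [hb, if_pos hi]; omega
    · intro i hi j hj
      have h1 : a i ≤ -v := by simpa [hS] using hi
      have h2 : -v < a j := by simpa [hS] using hj
      have h3 := hlt i j
      have hjn : (j : ℤ) < n := by exact_mod_cast j.2
      simp only [hb, if_pos hi, if_neg hj]
      by_cases h : a i = -v ∧ a j = -v + 1
      · have hij := h3 h.1 h.2
        have : j < i := lt_of_le_of_ne hij (by rintro rfl; omega)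
        have : (j : ℤ) < i := by exact_mod_cast this
        rw [h.1, h.2]; linarith
      · have : a i + 1 + 1 ≤ a j := by omega
        nlinarith [Int.natCast_nonneg i.val]

/-- Reduced monomials span the coinvariant algebra. -/
lemma span_reduced (n : ℕ) :
    Submodule.span ℂ {r | ∃ a : Fin n → ℤ, IsReducedExp a ∧ toRn n (monomial (signedExp a) 1) = r} =
      ⊤ := by
  set W := Submodule.span ℂ
    {r | ∃ a : Fin n → ℤ, IsReducedExp a ∧ toRn n (monomial (signedExp a) 1) = r}
  have main : ∀ (N : ℕ) (a : Fin n → ℤ), (weight a + n * n).toNat = N →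
      toRn n (monomial (signedExp a) 1) ∈ W := by
    intro N
    induction N using Nat.strong_induction_on with
    | _ N ih =>
      intro a hN
      by_cases ha : IsReducedExp a
      · exact Submodule.subset_span ⟨a, ha, rfl⟩
      · refine toRn_mem_of_not_isReduced a ha W fun a' ha' => ih _ ?_ a' rfl
        have h1 := weight_bound a
        have h2 := weight_bound a'
        omega
  rw [eq_top_iff]
  rintro r -
  obtain ⟨p, rfl⟩ := toRn_surjective n r
  induction p using MvPolynomial.induction_on' with
  | add p q hp hq => rw [map_add]; exact W.add_mem hp hq
  | monomial d c =>
    by_cases hd : ∃ i, d (Sum.inl i) ≠ 0 ∧ d (Sum.inr i) ≠ 0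
    · obtain ⟨i, h₁, h₂⟩ := hd
      rw [toRn_monomial_eq_zero h₁ h₂]; exact W.zero_mem
    · push Not at hd
      have hda : d = signedExp fun i => (d (Sum.inl i) : ℤ) - d (Sum.inr i) := by
        ext (i | i) <;> have := hd i <;> simp <;> omega
      rw [hda, ← mul_one c, ← smul_eq_mul, ← smul_monomial, map_smul]
      exact W.smul_mem _ (main _ _ rfl)

/-- `σ` has a descent between the positions `r` and `r + 1`. -/
def IsDesc {n : ℕ} (σ : Equiv.Perm (Fin n)) (r : ℕ) : Prop :=
  ∃ h : r + 1 < n, σ ⟨r + 1, h⟩ < σ ⟨r, Nat.lt_of_succ_lt h⟩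

open Classical in
/-- The number of descents of `σ` at positions before `r`. -/
def descCount {n : ℕ} (σ : Equiv.Perm (Fin n)) (r : ℕ) : ℕ :=
  ((Finset.range r).filter (IsDesc σ)).card

/-- The exponent of the signed descent monomial of `σ` whose zero block contains position `k`. -/
def descExp {n : ℕ} (σ : Equiv.Perm (Fin n)) (k : Fin n) (i : Fin n) : ℤ :=
  (descCount σ k : ℤ) - descCount σ (σ.symm i)

open Classical in
/-- Pairs of a permutation and the starting position of one of its ascending runs. -/
def descPairs (n : ℕ) : Finset (Equiv.Perm (Fin n) × Fin n) :=
  Finset.univ.filter fun p => (p.2 : ℕ) = 0 ∨ IsDesc p.1 (p.2 - 1)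

open Classical in
lemma descCount_succ {n : ℕ} (σ : Equiv.Perm (Fin n)) (r : ℕ) :
    descCount σ (r + 1) = descCount σ r + if IsDesc σ r then 1 else 0 := by
  rw [descCount, descCount, Finset.range_add_one, Finset.filter_insert]
  split_ifs
  · rw [Finset.card_insert_of_notMem (by simp)]
  · rfl

lemma descCount_mono {n : ℕ} (σ : Equiv.Perm (Fin n)) : Monotone (descCount σ) :=
  monotone_nat_of_le_succ fun r => by rw [descCount_succ]; omega

lemma descCount_le_add {n : ℕ} (σ : Equiv.Perm (Fin n)) {r s : ℕ} (h : r ≤ s) :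
    descCount σ s + r ≤ descCount σ r + s := by
  induction s, h using Nat.le_induction with
  | base => rfl
  | succ s _ ih => rw [descCount_succ]; split_ifs <;> omega

lemma Fin.strictAnti_of_succ_lt {n : ℕ} {f : Fin n → ℤ}
    (h : ∀ (r : ℕ) (hr : r + 1 < n), f ⟨r + 1, hr⟩ < f ⟨r, Nat.lt_of_succ_lt hr⟩) :
    StrictAnti f := by
  cases n with
  | zero => exact fun i => i.elim0
  | succ m => exact Fin.strictAnti_iff_succ_lt.2 fun i => h i (by omega)

lemma descExp_key_strictAnti {n : ℕ} (σ : Equiv.Perm (Fin n)) (k : Fin n) :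
    StrictAnti fun r : Fin n => (n : ℤ) * descExp σ k (σ r) - (σ r : ℕ) := by
  refine Fin.strictAnti_of_succ_lt fun r hr => ?_
  simp only [descExp, Equiv.symm_apply_apply]
  rw [descCount_succ]
  have h1 := (σ ⟨r, Nat.lt_of_succ_lt hr⟩).2
  split_ifs with h
  · push_cast; nlinarith
  · have h2 : σ ⟨r, Nat.lt_of_succ_lt hr⟩ < σ ⟨r + 1, hr⟩ := by
      refine lt_of_le_of_ne (not_lt.1 fun h' => h ⟨hr, h'⟩) fun h' => ?_
      simpa using σ.injective h'
    have h3 : ((σ ⟨r, Nat.lt_of_succ_lt hr⟩ : ℕ) : ℤ) < (σ ⟨r + 1, hr⟩ : ℕ) := by exact_mod_cast h2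
    push_cast; linarith

lemma compl_descExp_key_strictAnti {n : ℕ} (σ : Equiv.Perm (Fin n)) (k : Fin n) :
    StrictAnti fun r : Fin n =>
      (n : ℤ) * (((k : ℕ) : ℤ) - (r : ℕ) - descExp σ k (σ r)) + (σ r : ℕ) := by
  refine Fin.strictAnti_of_succ_lt fun r hr => ?_
  simp only [descExp, Equiv.symm_apply_apply]
  rw [descCount_succ]
  split_ifs with h
  · obtain ⟨_, h⟩ := h
    have h3 : ((σ ⟨r + 1, hr⟩ : ℕ) : ℤ) < (σ ⟨r, Nat.lt_of_succ_lt hr⟩ : ℕ) := by exact_mod_cast h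
    push_cast; linarith
  · have h1 := (σ ⟨r + 1, hr⟩).2
    push_cast; nlinarith

lemma perm_eq_of_strictAnti {n : ℕ} {f : Fin n → ℤ} {σ τ : Equiv.Perm (Fin n)}
    (hσ : StrictAnti fun r => f (σ r)) (hτ : StrictAnti fun r => f (τ r)) : σ = τ := by
  have h : f ∘ σ = f ∘ τ := Tuple.unique_antitone hσ.antitone hτ.antitone
  have hf : f.Injective := by
    have : (f ∘ σ) ∘ σ.symm = f := by ext; simp
    rw [← this]
    exact (show Function.Injective (f ∘ σ) from hσ.injective).comp σ.symm.injective
  exact Equiv.ext fun r => hf (congrFun h r)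

lemma descExp_injOn (n : ℕ) :
    Set.InjOn (fun p : Equiv.Perm (Fin n) × Fin n => descExp p.1 p.2) (descPairs n) := by
  have key : ∀ (σ : Equiv.Perm (Fin n)) (k l : Fin n), (σ, l) ∈ descPairs n →
      descCount σ k = descCount σ l → ¬ k < l := by
    intro σ k l hl h hkl
    have hkl' : (k : ℕ) < l := hkl
    simp only [descPairs, Finset.mem_filter, Finset.mem_univ, true_and] at hl
    have hd := hl.resolve_left (by omega)
    have h1 := descCount_succ σ (l - 1)
    rw [if_pos hd, Nat.sub_add_cancel (by omega)] at h1
    have h2 := descCount_mono σ (show (k : ℕ) ≤ l - 1 by omega)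
    omega
  rintro ⟨σ, k⟩ hk ⟨τ, l⟩ hl h
  simp only at h
  have h1 := descExp_key_strictAnti σ k
  have h2 := descExp_key_strictAnti τ l
  rw [← h] at h2
  obtain rfl : σ = τ := perm_eq_of_strictAnti (f := fun i => n * descExp σ k i - (i : ℕ)) h1 h2
  have h3 := congrFun h (σ k)
  simp only [descExp] at h3
  have h4 : descCount σ k = descCount σ l := by omega
  have h5 : k = l := le_antisymm (not_lt.1 (key σ l k hk h4.symm)) (not_lt.1 (key σ k l hl h4))
  rw [h5]

/-- Every reduced exponent is the exponent of a signed descent monomial. -/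
lemma exists_descExp_eq {n : ℕ} (hn : 1 ≤ n) {a : Fin n → ℤ} (ha : IsReducedExp a) :
    ∃ p ∈ descPairs n, descExp p.1 p.2 = a := by
  set β : Fin n → ℤ := fun i => -(n * a i - (i : ℕ)) with hβ
  have hβinj : β.Injective := by
    intro i j hij
    have hi : ((i : ℕ) : ℤ) < n := by exact_mod_cast i.2
    have hj : ((j : ℕ) : ℤ) < n := by exact_mod_cast j.2
    simp only [hβ] at hij
    have : a i = a j := by
      rcases lt_trichotomy (a i) (a j) with h | h | h
      · nlinarith
      · exact h
      · nlinarith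
    rw [this] at hij
    exact Fin.ext (by omega)
  set σ := Tuple.sort β
  have hσ : StrictMono (β ∘ σ) :=
    (Tuple.monotone_sort β).strictMono_of_injective (hβinj.comp σ.injective)
  have anti : ∀ r s : Fin n, r ≤ s → a (σ s) ≤ a (σ r) := by
    intro r s hrs
    have h := hσ.monotone hrs
    have hi : ((σ s : ℕ) : ℤ) < n := by exact_mod_cast (σ s).2
    simp only [hβ, Function.comp] at h
    by_contra! h'
    nlinarith [Int.natCast_nonneg (σ r : ℕ)]
  have lt_of_eq : ∀ i j : Fin n, a i = a j → i ≤ j → σ.symm i ≤ σ.symm j := by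
    intro i j h hij
    rw [← hσ.le_iff_le]
    have : ((i : ℕ) : ℤ) ≤ (j : ℕ) := by exact_mod_cast hij
    simp only [hβ, Function.comp, Equiv.apply_symm_apply, h]
    linarith
  have le_of_eq : ∀ r s : Fin n, a (σ r) = a (σ s) → r ≤ s → σ r ≤ σ s := by
    intro r s h hrs
    by_contra! h'
    have := lt_of_eq _ _ h.symm h'.le
    simp only [Equiv.symm_apply_apply] at this
    have : r = s := le_antisymm hrs this
    subst this
    exact lt_irrefl _ h'
  have pos_of_lt : ∀ (r : Fin n) (i : Fin n), a (σ r) < a i → σ.symm i < r := by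
    intro r i h
    by_contra! h'
    have := anti _ _ h'
    rw [Equiv.apply_symm_apply] at this
    omega
  have lt_pos_of_lt : ∀ (r : Fin n) (i : Fin n), a i < a (σ r) → r < σ.symm i := by
    intro r i h
    by_contra! h'
    have := anti _ _ h'
    rw [Equiv.apply_symm_apply] at this
    omega
  have step : ∀ (r : ℕ) (hr : r + 1 < n),
      a (σ ⟨r, Nat.lt_of_succ_lt hr⟩) ≠ a (σ ⟨r + 1, hr⟩) →
      a (σ ⟨r, Nat.lt_of_succ_lt hr⟩) = a (σ ⟨r + 1, hr⟩) + 1 ∧ IsDesc σ r := by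
    intro r hr hne
    set r₀ : Fin n := ⟨r, Nat.lt_of_succ_lt hr⟩
    set r₁ : Fin n := ⟨r + 1, hr⟩
    have hlt : a (σ r₁) < a (σ r₀) := lt_of_le_of_ne (anti r₀ r₁ (by simp [r₀, r₁])) hne.symm
    have drop : ∀ i j : Fin n, j < i → a i = a j + 1 → a (σ r₁) < a i → a j < a (σ r₀) →
        (a i = a (σ r₀) ∨ a j = a (σ r₁)) →
        a (σ r₀) = a (σ r₁) + 1 ∧ IsDesc σ r := by
      intro i j hji haij h1 h2 h3
      have hi := pos_of_lt _ _ h1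
      have hj := lt_pos_of_lt _ _ h2
      have hi' : σ.symm i ≤ r₀ := by
        rw [Fin.lt_def] at hi; rw [Fin.le_def]; simp only [r₁] at hi; simp only [r₀]; omega
      have hj' : r₁ ≤ σ.symm j := by
        rw [Fin.lt_def] at hj; rw [Fin.le_def]; simp only [r₀] at hj; simp only [r₁]; omega
      have h4 := anti _ _ hi'
      have h5 := anti _ _ hj'
      rw [Equiv.apply_symm_apply] at h4 h5
      have e1 : a i = a (σ r₀) := by omega
      have e2 : a j = a (σ r₁) := by omega
      have h6 := le_of_eq _ _ (by rw [Equiv.apply_symm_apply, e1]) hi'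
      have h7 := le_of_eq _ _ (by rw [Equiv.apply_symm_apply, e2]) hj'
      rw [Equiv.apply_symm_apply] at h6 h7
      exact ⟨by omega, hr, h7.trans_lt (hji.trans_le h6)⟩
    rcases le_or_gt 1 (a (σ r₀)) with h | h
    · obtain ⟨i, j, hi, hj, hji⟩ := ha.1 _ h ⟨_, le_rfl⟩
      exact drop i j hji (by omega) (by omega) (by omega) (Or.inl hi)
    · obtain ⟨i, j, hi, hj, hij⟩ := ha.2 (-a (σ r₁)) (by omega) ⟨σ r₁, by omega⟩
      exact drop j i hij (by omega) (by omega) (by omega) (Or.inr (by omega))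
  have count : ∀ (r : ℕ) (hr : r < n), a (σ ⟨r, hr⟩) = a (σ ⟨0, hn⟩) - descCount σ r := by
    intro r
    induction r with
    | zero => intro _; simp [descCount]
    | succ r ih =>
      intro hr
      have h1 := ih (Nat.lt_of_succ_lt hr)
      rw [descCount_succ]
      by_cases h : a (σ ⟨r, Nat.lt_of_succ_lt hr⟩) = a (σ ⟨r + 1, hr⟩)
      · have h2 := le_of_eq _ _ h (by simp)
        rw [if_neg (fun h3 => absurd h3.2 (not_lt.2 h2))]
        push_cast; omega
      · obtain ⟨h2, h3⟩ := step r hr h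
        rw [if_pos h3]; push_cast; omega
  have hex : ∃ r, ∃ hr : r < n, a (σ ⟨r, hr⟩) ≤ 0 := by
    rcases le_or_gt (a (σ ⟨0, hn⟩)) 0 with h | h
    · exact ⟨0, hn, h⟩
    · obtain ⟨i, j, -, hj, -⟩ := ha.1 1 le_rfl ⟨_, h⟩
      exact ⟨σ.symm j, (σ.symm j).2, by simp [hj]⟩
  classical
  obtain ⟨k, ⟨hkn, hk0⟩, hmin⟩ : ∃ k, (∃ hr : k < n, a (σ ⟨k, hr⟩) ≤ 0) ∧
      ∀ m < k, ¬ ∃ hr : m < n, a (σ ⟨m, hr⟩) ≤ 0 :=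
    ⟨Nat.find hex, Nat.find_spec hex, fun m hm => Nat.find_min hex hm⟩
  have hk : a (σ ⟨k, hkn⟩) = 0 ∧ (k = 0 ∨ IsDesc σ (k - 1)) := by
    rcases Nat.eq_zero_or_pos k with h | h
    · refine ⟨?_, Or.inl h⟩
      by_contra h0
      have hlt : a (σ ⟨k, hkn⟩) < 0 := lt_of_le_of_ne hk0 h0
      obtain ⟨i, j, hi, hj, -⟩ := ha.2 (-a (σ ⟨k, hkn⟩)) (by omega) ⟨_, by rw [neg_neg]⟩
      have := pos_of_lt ⟨k, hkn⟩ j (by omega)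
      rw [Fin.lt_def] at this
      simp only at this
      omega
    · obtain ⟨m, rfl⟩ : ∃ m, k = m + 1 := ⟨k - 1, by omega⟩
      have h1 := hmin m (by omega)
      push Not at h1
      have h1 := h1 (by omega)
      obtain ⟨h2, h3⟩ := step m hkn (by omega)
      exact ⟨by omega, Or.inr (by simpa using h3)⟩
  refine ⟨(σ, ⟨k, hkn⟩), by simpa [descPairs] using hk.2, ?_⟩
  ext i
  have h1 := count k hkn
  have h2 := count (σ.symm i) (σ.symm i).2
  simp only [Fin.eta, Equiv.apply_symm_apply] at h2
  simp only [descExp]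
  omega

open Classical in
lemma two_mul_card_filter_isDesc {n r : ℕ} (hr : r + 1 < n) :
    2 * (Finset.univ.filter fun σ : Equiv.Perm (Fin n) => IsDesc σ r).card = n.factorial := by
  set s : Equiv.Perm (Fin n) := Equiv.swap ⟨r, Nat.lt_of_succ_lt hr⟩ ⟨r + 1, hr⟩ with hs
  have h1 : (Finset.univ.filter fun σ : Equiv.Perm (Fin n) => IsDesc σ r).card =
      (Finset.univ.filter fun σ : Equiv.Perm (Fin n) => ¬ IsDesc σ r).card := by
    have key : ∀ σ : Equiv.Perm (Fin n), IsDesc (σ * s) r ↔ ¬ IsDesc σ r := by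
      intro σ
      have hne : σ ⟨r, Nat.lt_of_succ_lt hr⟩ ≠ σ ⟨r + 1, hr⟩ := fun h => by
        simpa using σ.injective h
      simp only [IsDesc, hr, exists_true_left, hs, Equiv.Perm.mul_apply, Equiv.swap_apply_left,
        Equiv.swap_apply_right, not_lt]
      exact ⟨le_of_lt, fun h => lt_of_le_of_ne h hne⟩
    refine Finset.card_bij (fun σ _ => σ * s) (fun σ hσ => ?_) (fun σ _ τ _ h => mul_right_cancel h)
      fun σ hσ => ⟨σ * s, ?_, ?_⟩
    · simp only [Finset.mem_filter, Finset.mem_univ, true_and] at hσ ⊢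
      rw [key]; exact not_not.2 hσ
    · simp only [Finset.mem_filter, Finset.mem_univ, true_and] at hσ ⊢
      rw [key]; exact hσ
    · rw [mul_assoc, hs, Equiv.swap_mul_self, mul_one]
  have h2 := Finset.card_filter_add_card_filter_not (s := Finset.univ)
    (fun σ : Equiv.Perm (Fin n) => IsDesc σ r)
  rw [Finset.card_univ, Fintype.card_perm, Fintype.card_fin] at h2
  omega

lemma two_mul_card_descPairs {n : ℕ} (hn : 1 ≤ n) :
    2 * (descPairs n).card = (n + 1).factorial := by
  classical
  obtain ⟨m, rfl⟩ : ∃ m, n = m + 1 := ⟨n - 1, by omega⟩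
  have h1 : (descPairs (m + 1)).card = ∑ k : Fin (m + 1), (Finset.univ.filter
      fun σ : Equiv.Perm (Fin (m + 1)) => (k : ℕ) = 0 ∨ IsDesc σ (k - 1)).card := by
    rw [descPairs, Finset.card_filter, Fintype.sum_prod_type, Finset.sum_comm]
    refine Finset.sum_congr rfl fun k _ => ?_
    rw [Finset.card_filter]
  rw [h1, Fin.sum_univ_succ, mul_add, Finset.mul_sum]
  have h2 : ∀ j : Fin m, 2 * (Finset.univ.filter
      fun σ : Equiv.Perm (Fin (m + 1)) => (j.succ : ℕ) = 0 ∨ IsDesc σ (j.succ - 1)).card =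
      (m + 1).factorial := by
    intro j
    simp only [Fin.val_succ, Nat.add_eq_zero_iff, one_ne_zero, and_false, false_or,
      Nat.add_sub_cancel]
    exact two_mul_card_filter_isDesc (by omega)
  simp only [h2]
  simp [Fintype.card_perm, Nat.factorial_succ (m + 1)]
  ring

/-- The determinant of the `0`-`1` matrix recording which entries of `a` equal `k - j`. It is
the sign of the permutation `i ↦ k - a i` if this is a permutation, and `0` otherwise. -/
def altCoeff {n : ℕ} (k : Fin n) (a : Fin n → ℤ) : ℂ :=
  Matrix.det (Matrix.of fun i j : Fin n =>
    if a i = ((k : ℕ) : ℤ) - ((j : ℕ) : ℤ) then (1 : ℂ) else 0)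

lemma altCoeff_comp_perm {n : ℕ} (k : Fin n) (a : Fin n → ℤ) (τ : Equiv.Perm (Fin n)) :
    altCoeff k (a ∘ τ) = (Equiv.Perm.sign τ : ℤ) * altCoeff k a :=
  Matrix.det_permute τ (Matrix.of fun i j : Fin n =>
    if a i = ((k : ℕ) : ℤ) - ((j : ℕ) : ℤ) then (1 : ℂ) else 0)

lemma exists_perm_of_altCoeff_ne_zero {n : ℕ} {k : Fin n} {a : Fin n → ℤ} (h : altCoeff k a ≠ 0) :
    ∃ τ : Equiv.Perm (Fin n), ∀ i, a i = ((k : ℕ) : ℤ) - ((τ i : ℕ) : ℤ) := by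
  rw [altCoeff, ← Matrix.det_transpose, Matrix.det_apply] at h
  obtain ⟨τ, -, hτ⟩ := Finset.exists_ne_zero_of_sum_ne_zero h
  refine ⟨τ, fun i => ?_⟩
  by_contra hi
  refine hτ ?_
  rw [Finset.prod_eq_zero (Finset.mem_univ i) (by simp [hi]), smul_zero]

lemma altCoeff_perm_ne_zero {n : ℕ} (k : Fin n) (τ : Equiv.Perm (Fin n)) :
    altCoeff k (fun i => ((k : ℕ) : ℤ) - ((τ i : ℕ) : ℤ)) ≠ 0 := by
  have h := altCoeff_comp_perm k (fun i : Fin n => ((k : ℕ) : ℤ) - ((i : ℕ) : ℤ)) τ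
  have h1 : altCoeff k (fun i : Fin n => ((k : ℕ) : ℤ) - ((i : ℕ) : ℤ)) = 1 := by
    rw [altCoeff, ← Matrix.det_one (n := Fin n)]
    congr 1
    ext i j
    simp [Matrix.one_apply, Fin.ext_iff]
  rw [h1, mul_one] at h
  have h2 : (fun i => ((k : ℕ) : ℤ) - ((τ i : ℕ) : ℤ)) =
    (fun i : Fin n => ((k : ℕ) : ℤ) - ((i : ℕ) : ℤ)) ∘ τ := rfl
  rw [h2, h]
  exact_mod_cast (Equiv.Perm.sign τ).ne_zero

/-- The signed exponent of a monomial: `x`-degrees minus `y`-degrees. -/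
def signedDiff {n : ℕ} (d : Fin n ⊕ Fin n →₀ ℕ) (i : Fin n) : ℤ := d (Sum.inl i) - d (Sum.inr i)

/-- No `x_i` and `y_i` occur together in the monomial with exponent `d`. -/
def IsSeparated {n : ℕ} (d : Fin n ⊕ Fin n →₀ ℕ) : Prop :=
  ∀ i, d (Sum.inl i) = 0 ∨ d (Sum.inr i) = 0

open Classical in
/-- The linear functional pairing a polynomial with an alternating sum of separated monomials. -/
def altFunctional {n : ℕ} (k : Fin n) : MvPolynomial (Fin n ⊕ Fin n) ℂ →ₗ[ℂ] ℂ :=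
  (basisMonomials (Fin n ⊕ Fin n) ℂ).constr ℂ fun d =>
    if IsSeparated d then altCoeff k (signedDiff d) else 0

open Classical in
lemma altFunctional_monomial {n : ℕ} (k : Fin n) (d : Fin n ⊕ Fin n →₀ ℕ) (c : ℂ) :
    altFunctional k (monomial d c) =
      c * if IsSeparated d then altCoeff k (signedDiff d) else 0 := by
  have h : altFunctional k (monomial d (1 : ℂ)) =
      if IsSeparated d then altCoeff k (signedDiff d) else 0 := by
    have h1 : monomial d (1 : ℂ) = basisMonomials (Fin n ⊕ Fin n) ℂ d := by simp
    rw [h1, altFunctional, Module.Basis.constr_basis]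
  rw [← mul_one c, ← smul_eq_mul, ← smul_monomial, map_smul, h, smul_eq_mul, smul_eq_mul, mul_one]

lemma altFunctional_mul_of_mem_Bideal {n : ℕ} (k : Fin n) {p : MvPolynomial (Fin n ⊕ Fin n) ℂ}
    (hp : p ∈ Bideal n) (q : MvPolynomial (Fin n ⊕ Fin n) ℂ) : altFunctional k (q * p) = 0 := by
  induction hp using Submodule.span_induction generalizing q with
  | mem p hp =>
    obtain ⟨i, rfl⟩ := hp
    induction q using MvPolynomial.induction_on' with
    | add q₁ q₂ h₁ h₂ => rw [add_mul, map_add, h₁, h₂, add_zero]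
    | monomial d c =>
      simp only [X, monomial_mul]
      rw [altFunctional_monomial, if_neg, mul_zero]
      intro h
      have := h i
      simp at this
  | zero => rw [mul_zero, map_zero]
  | add p₁ p₂ _ _ h₁ h₂ => rw [mul_add, map_add, h₁, h₂, add_zero]
  | smul r p _ h => rw [smul_eq_mul, ← mul_assoc, h]

lemma mapDomain_sumMap_apply {n : ℕ} (τ : Equiv.Perm (Fin n)) (d : Fin n ⊕ Fin n →₀ ℕ) (i : Fin n) :
    d.mapDomain (Sum.map τ τ) (Sum.inl i) = d (Sum.inl (τ.symm i)) ∧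
    d.mapDomain (Sum.map τ τ) (Sum.inr i) = d (Sum.inr (τ.symm i)) := by
  have hinj : Function.Injective (Sum.map τ τ) := Sum.map_injective.2 ⟨τ.injective, τ.injective⟩
  constructor
  · simpa using Finsupp.mapDomain_apply hinj d (Sum.inl (τ.symm i))
  · simpa using Finsupp.mapDomain_apply hinj d (Sum.inr (τ.symm i))

lemma altFunctional_rename {n : ℕ} (k : Fin n) (τ : Equiv.Perm (Fin n))
    (p : MvPolynomial (Fin n ⊕ Fin n) ℂ) :
    altFunctional k (rename (Sum.map τ τ) p) = (Equiv.Perm.sign τ : ℤ) * altFunctional k p := by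
  classical
  induction p using MvPolynomial.induction_on' with
  | add p q hp hq => rw [map_add, map_add, map_add, hp, hq, mul_add]
  | monomial d c =>
    have h1 : signedDiff (d.mapDomain (Sum.map τ τ)) = signedDiff d ∘ τ.symm := by
      ext i
      simp only [signedDiff, mapDomain_sumMap_apply, Function.comp]
    have h2 : IsSeparated (d.mapDomain (Sum.map τ τ)) ↔ IsSeparated d := by
      simp only [IsSeparated, mapDomain_sumMap_apply]
      exact τ.symm.forall_congr_right (q := fun i => d (Sum.inl i) = 0 ∨ d (Sum.inr i) = 0)
    rw [rename_monomial, altFunctional_monomial, altFunctional_monomial, h1, altCoeff_comp_perm,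
      Equiv.Perm.sign_symm]
    simp only [h2]
    split_ifs <;> ring

/-- A separated exponent with signed entries `k - τ i` has no proper divisor whose signed entries
are pairwise distinct. -/
lemma eq_zero_of_isSeparated_add {n : ℕ} {k : Fin n} {b d : Fin n ⊕ Fin n →₀ ℕ}
    {τ : Equiv.Perm (Fin n)} (hsep : IsSeparated (b + d))
    (hτ : ∀ i, signedDiff (b + d) i = ((k : ℕ) : ℤ) - ((τ i : ℕ) : ℤ))
    (hb : Function.Injective (signedDiff b)) : d = 0 := by
  have hn : ∀ i : Fin n, 0 ≤ ((k : ℕ) : ℤ) - signedDiff b i ∧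
      ((k : ℕ) : ℤ) - signedDiff b i < n := by
    intro i
    have h1 := hsep i
    have h2 := hτ i
    have h3 := (τ i).2
    have h4 := k.2
    simp only [signedDiff, Finsupp.add_apply] at h1 h2 ⊢
    omega
  set f : Fin n → Fin n := fun i => ⟨(((k : ℕ) : ℤ) - signedDiff b i).toNat, by
    have := hn i; omega⟩ with hf
  have hfi : ∀ i, signedDiff b i = ((k : ℕ) : ℤ) - ((f i : ℕ) : ℤ) := by
    intro i
    have := hn i
    simp only [hf]; omega
  have hinj : Function.Injective f := fun i j h => hb (by rw [hfi, hfi, h])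
  have hsum : ∑ i, |signedDiff b i| = ∑ i, |signedDiff (b + d) i| := by
    simp only [hfi, hτ]
    rw [Equiv.sum_comp τ fun i : Fin n => |((k : ℕ) : ℤ) - ((i : ℕ) : ℤ)|]
    exact Equiv.sum_comp (Equiv.ofBijective f (Finite.injective_iff_bijective.1 hinj))
      fun i : Fin n => |((k : ℕ) : ℤ) - ((i : ℕ) : ℤ)|
  have hle : ∀ i ∈ Finset.univ, |signedDiff b i| ≤ |signedDiff (b + d) i| := by
    intro i _
    have h1 := hsep i
    simp only [signedDiff, Finsupp.add_apply, Int.abs_eq_natAbs] at h1 ⊢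
    omega
  have heq := (Finset.sum_eq_sum_iff_of_le hle).1 hsum
  ext (i | i) <;>
  · have h1 := hsep i
    have h2 := heq i (Finset.mem_univ i)
    simp only [signedDiff, Finsupp.add_apply, Finsupp.zero_apply, Int.abs_eq_natAbs] at h1 h2 ⊢
    omega

lemma altFunctional_mul_of_invariant {n : ℕ} (k : Fin n) {p : MvPolynomial (Fin n ⊕ Fin n) ℂ}
    (hp : ∀ σ : Equiv.Perm (Fin n), rename (Sum.map σ σ) p - p ∈ Bideal n)
    (hp0 : constantCoeff p = 0) (q : MvPolynomial (Fin n ⊕ Fin n) ℂ) :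
    altFunctional k (q * p) = 0 := by
  classical
  induction q using MvPolynomial.induction_on' with
  | add q₁ q₂ h₁ h₂ => rw [add_mul, map_add, h₁, h₂, add_zero]
  | monomial b c =>
    by_cases hb : ∃ i j, i ≠ j ∧ b (Sum.inl i) = b (Sum.inl j) ∧ b (Sum.inr i) = b (Sum.inr j)
    · obtain ⟨i, j, hij, hl, hr⟩ := hb
      have hfix : b.mapDomain (Sum.map (Equiv.swap i j) (Equiv.swap i j)) = b := by
        ext (m | m)
        · rw [(mapDomain_sumMap_apply _ _ _).1, Equiv.symm_swap]
          exact Equiv.apply_swap_eq_self (v := fun m => b (Sum.inl m)) hl m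
        · rw [(mapDomain_sumMap_apply _ _ _).2, Equiv.symm_swap]
          exact Equiv.apply_swap_eq_self (v := fun m => b (Sum.inr m)) hr m
      have h1 := altFunctional_rename k (Equiv.swap i j) (monomial b c * p)
      have h2 := altFunctional_mul_of_mem_Bideal k (hp (Equiv.swap i j)) (monomial b c)
      rw [map_mul, rename_monomial, hfix, Equiv.Perm.sign_swap hij] at h1
      rw [mul_sub, map_sub, h1] at h2
      push_cast at h2
      linear_combination (-1 / 2 : ℂ) * h2
    · push Not at hb
      rw [p.as_sum, Finset.mul_sum, map_sum]
      refine Finset.sum_eq_zero fun d hd => ?_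
      rw [monomial_mul, altFunctional_monomial]
      split_ifs with hsep
      · by_contra h
        obtain ⟨τ, hτ⟩ := exists_perm_of_altCoeff_ne_zero (right_ne_zero_of_mul h)
        obtain rfl := eq_zero_of_isSeparated_add hsep hτ fun i j hij => by
          by_contra hne
          have h1 := hsep i
          have h2 := hsep j
          have h3 := hb i j hne
          simp only [signedDiff, Finsupp.add_apply] at hij h1 h2
          omega
        rw [mem_support_iff] at hd
        exact hd hp0
      · rw [mul_zero]

/-- The functionals `altFunctional` are well defined on the coinvariant algebra. -/
lemma altFunctional_mul_eq_zero {n : ℕ} (k : Fin n) {p : MvPolynomial (Fin n ⊕ Fin n) ℂ}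
    (hp : toRn n p = 0) (q : MvPolynomial (Fin n ⊕ Fin n) ℂ) : altFunctional k (q * p) = 0 := by
  rw [toRn_eq_zero_iff] at hp
  have hsurj := Ideal.Quotient.mkₐ_surjective ℂ (Bideal n)
  have main : ∀ r ∈ Jn n, ∃ p, mkB n p = r ∧ ∀ q, altFunctional k (q * p) = 0 := by
    intro r hr
    induction hr using Submodule.span_induction with
    | mem r hr =>
      obtain ⟨p, rfl⟩ := hsurj r
      refine ⟨p, rfl, altFunctional_mul_of_invariant k (fun σ => ?_) ?_⟩
      · rw [← mkB_eq_zero_iff, map_sub, ← permB_mkB, hr.1 σ, sub_self]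
      · rw [← ev0_mkB]; exact hr.2
    | zero => exact ⟨0, map_zero _, fun q => by rw [mul_zero, map_zero]⟩
    | add r₁ r₂ _ _ h₁ h₂ =>
      obtain ⟨p₁, rfl, h₁⟩ := h₁
      obtain ⟨p₂, rfl, h₂⟩ := h₂
      exact ⟨p₁ + p₂, map_add _ _ _, fun q => by rw [mul_add, map_add, h₁, h₂, add_zero]⟩
    | smul s r _ h =>
      obtain ⟨p, rfl, h⟩ := h
      obtain ⟨s, rfl⟩ := hsurj s
      exact ⟨s * p, map_mul _ _ _, fun q => by rw [← mul_assoc, h]⟩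
  obtain ⟨p', hp', h⟩ := main _ hp
  have h1 : p - p' ∈ Bideal n := by rw [← mkB_eq_zero_iff, map_sub, hp', sub_self]
  have h2 := altFunctional_mul_of_mem_Bideal k h1 q
  rwa [mul_sub, map_sub, h, sub_zero] at h2

lemma signedDiff_signedExp_add {n : ℕ} (a b : Fin n → ℤ) (i : Fin n) :
    signedDiff (signedExp a + signedExp b) i = a i + b i := by
  simp only [signedDiff, Finsupp.add_apply, signedExp_inl, signedExp_inr]
  omega

/-- The exponent complementary to `descExp σ k` with respect to `k - σ⁻¹`. -/
def complExp {n : ℕ} (σ : Equiv.Perm (Fin n)) (k i : Fin n) : ℤ :=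
  ((k : ℕ) : ℤ) - ((σ.symm i : ℕ) : ℤ) - descExp σ k i

lemma altFunctional_complExp_mul_descExp_ne_zero {n : ℕ} (σ : Equiv.Perm (Fin n)) (k : Fin n) :
    altFunctional k (monomial (signedExp (complExp σ k)) 1 * monomial (signedExp (descExp σ k)) 1) ≠
      0 := by
  classical
  rw [monomial_mul, altFunctional_monomial, if_pos, one_mul, one_mul]
  · have : signedDiff (signedExp (complExp σ k) + signedExp (descExp σ k)) =
        fun i => ((k : ℕ) : ℤ) - ((σ.symm i : ℕ) : ℤ) := by
      ext i
      rw [signedDiff_signedExp_add, complExp]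
      ring
    rw [this]
    exact altCoeff_perm_ne_zero k σ.symm
  · intro i
    simp only [Finsupp.add_apply, signedExp_inl, signedExp_inr, complExp, descExp]
    rcases le_total (k : ℕ) (σ.symm i) with h | h
    · have h1 := descCount_mono σ h
      have h2 := descCount_le_add σ h
      omega
    · have h1 := descCount_mono σ h
      have h2 := descCount_le_add σ h
      omega

lemma weight_eq_of_add {n : ℕ} (a b c : Fin n → ℤ) (h : ∀ i, b i + a i = c i) :
    weight a = n * ∑ i, c i ^ 2 - 2 * ∑ i, c i * (n * b i + (i : ℕ)) +
      ∑ i, (n * b i ^ 2 + 2 * (i : ℕ) * b i) := by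
  rw [weight, Finset.mul_sum, Finset.mul_sum, ← Finset.sum_sub_distrib, ← Finset.sum_add_distrib]
  refine Finset.sum_congr rfl fun i _ => ?_
  rw [← h i]
  ring

/-- The pairing of descent monomials with their complements is triangular for the weight. -/
lemma weight_le_of_altFunctional_ne_zero {n : ℕ} {σ : Equiv.Perm (Fin n)} {k : Fin n}
    {a : Fin n → ℤ}
    (h : altFunctional k (monomial (signedExp (complExp σ k)) 1 * monomial (signedExp a) 1) ≠ 0) :
    weight (descExp σ k) ≤ weight a ∧ (weight (descExp σ k) = weight a → descExp σ k = a) := by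
  classical
  rw [monomial_mul, altFunctional_monomial] at h
  obtain ⟨τ, hτ⟩ := exists_perm_of_altCoeff_ne_zero
    (show altCoeff k (signedDiff (signedExp (complExp σ k) + signedExp a)) ≠ 0 from fun h0 => by
      simp [h0] at h)
  set c : Fin n → ℤ := fun i => ((k : ℕ) : ℤ) - ((σ.symm i : ℕ) : ℤ) with hc
  set κ : Fin n → ℤ := fun i => n * complExp σ k i + (i : ℕ) with hκ
  set ρ : Equiv.Perm (Fin n) := τ.trans σ with hρ
  have h1 : ∀ i, complExp σ k i + a i = c (ρ i) := by
    intro i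
    rw [← signedDiff_signedExp_add, hτ]
    simp [hc, hρ]
  have h2 : ∀ i, complExp σ k i + descExp σ k i = c i := by
    intro i
    simp only [complExp, hc]; ring
  have hanti : StrictAnti fun r => κ (σ r) := by
    simpa [hκ, complExp] using compl_descExp_key_strictAnti σ k
  have hcσ : Antitone (c ∘ σ) := by
    intro r s hrs
    have : (r : ℕ) ≤ s := hrs
    simp only [hc, Function.comp, Equiv.symm_apply_apply]
    omega
  have hmono : Monovary c κ := by
    intro i j hij
    have h3 : σ.symm j < σ.symm i := by
      rw [← hanti.lt_iff_gt]
      simpa using hij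
    simpa using hcσ h3.le
  have hw := weight_eq_of_add _ _ _ h1
  have hw' := weight_eq_of_add _ _ _ h2
  rw [Equiv.sum_comp ρ fun i => c i ^ 2] at hw
  have hle := hmono.sum_comp_perm_mul_le_sum_mul (σ := ρ)
  refine ⟨by linarith, fun heq => ?_⟩
  have hmono' := (hmono.sum_comp_perm_mul_eq_sum_mul_iff (σ := ρ)).1 (by linarith)
  have hanti' : Antitone (c ∘ (σ.trans ρ)) := by
    intro r s hrs
    rcases hrs.eq_or_lt with rfl | hrs
    · rfl
    · exact hmono' (hanti hrs)
  have h3 := Tuple.unique_antitone hanti' hcσ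
  ext i
  have h4 := congrFun h3 (σ.symm i)
  simp only [Function.comp, Equiv.trans_apply, Equiv.apply_symm_apply] at h4
  have h5 := h1 i
  have h6 := h2 i
  have h7 : c (ρ i) = c i := by simpa [hρ] using h4
  linarith

/-- The class in the coinvariant algebra of a signed descent monomial. -/
def descMonomial {n : ℕ} (p : descPairs n) : Rn n :=
  toRn n (monomial (signedExp (descExp p.1.1 p.1.2)) 1)

lemma linearIndependent_descMonomial (n : ℕ) : LinearIndependent ℂ (descMonomial (n := n)) := by
  classical
  rw [Fintype.linearIndependent_iff]
  intro g hg
  by_contra! hne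
  obtain ⟨i, hi⟩ := hne
  obtain ⟨p, hp, hmax⟩ := Finset.exists_max_image (Finset.univ.filter fun p => g p ≠ 0)
    (fun p : descPairs n => weight (descExp p.1.1 p.1.2)) ⟨i, by simpa using hi⟩
  have hgp : g p ≠ 0 := by simpa using hp
  have h1 : toRn n (∑ q, g q • monomial (signedExp (descExp q.1.1 q.1.2)) 1) = 0 := by
    rw [map_sum, ← hg]
    exact Finset.sum_congr rfl fun q _ => map_smul _ _ _
  have h2 := altFunctional_mul_eq_zero p.1.2 h1 (monomial (signedExp (complExp p.1.1 p.1.2)) 1)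
  rw [Finset.mul_sum, map_sum, Finset.sum_eq_single p] at h2
  · rw [mul_smul_comm, map_smul, smul_eq_mul] at h2
    exact mul_ne_zero hgp (altFunctional_complExp_mul_descExp_ne_zero _ _) h2
  · intro q _ hqp
    rw [mul_smul_comm, map_smul, smul_eq_mul]
    by_contra h
    obtain ⟨h3, h4⟩ := weight_le_of_altFunctional_ne_zero (right_ne_zero_of_mul h)
    have h5 := hmax q (by simpa using left_ne_zero_of_mul h)
    exact hqp (Subtype.ext (descExp_injOn n p.2 q.2 (h4 (le_antisymm h3 h5))).symm)
  · simp

lemma span_descMonomial {n : ℕ} (hn : 1 ≤ n) :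
    ⊤ ≤ Submodule.span ℂ (Set.range (descMonomial (n := n))) := by
  rw [← span_reduced n]
  refine Submodule.span_mono ?_
  rintro _ ⟨a, ha, rfl⟩
  obtain ⟨p, hp, rfl⟩ := exists_descExp_eq hn ha
  exact ⟨⟨p, hp⟩, rfl⟩

/-- The signed descent monomials form a basis of the coinvariant algebra. -/
def descBasis {n : ℕ} (hn : 1 ≤ n) : Module.Basis (descPairs n) ℂ (Rn n) :=
  Module.Basis.mk (linearIndependent_descMonomial n) (span_descMonomial hn)

/-- For every `n ≥ 1`, the symmetric coinvariant algebra `Rₙ = Bₙ/Jₙ`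
is finite dimensional over `ℂ`, of dimension `n! + (n−1)·n!/2 = (n+1)!/2`. -/
theorem dim_symmetric_coinvariant_algebra (n : ℕ) (hn : 1 ≤ n) :
    FiniteDimensional ℂ (Rn n) ∧
    Module.finrank ℂ (Rn n) = n.factorial + (n - 1) * n.factorial / 2 ∧
    Module.finrank ℂ (Rn n) = (n + 1).factorial / 2 := by
  have hcard := two_mul_card_descPairs hn
  have hrank : Module.finrank ℂ (Rn n) = (descPairs n).card := by
    rw [Module.finrank_eq_card_basis (descBasis hn), Fintype.card_coe]
  refine ⟨Module.Finite.of_basis (descBasis hn), ?_, by omega⟩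
  have h : (n - 1) * n.factorial + 2 * n.factorial = (n + 1).factorial := by
    rw [Nat.factorial_succ, ← add_mul]
    congr 1
    omega
  omega

end
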